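/- arXiv:2110.09323 — 2 statements merged into one kernel-verified Lean document; each statement's English description precedes it below -/
import Mathlib

section
/- If T ≥ 4 k log k, then ∫_T^∞ ∫_{−1/2}^{1/2} y^{k−2} |f(x+iy)|² dx dy ≤ 2 (4π)^{1−k} ∑_{n=1}^∞ |a(n)|² n^{1−k} e^{−2πnT}. -/
open Real MeasureTheory

/-- **Parseval's identity** on `[-1/2, 1/2]` for absolutely convergent one-sided Fourier series. -/
theorem hasSum_sq_norm_fourierSeries (c : ℕ → ℂ) (hc : Summable fun n => ‖c n‖) (g : ℝ → ℂ)
    (hg : ∀ x : ℝ,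
      HasSum (fun n => c n * Complex.exp (2 * π * Complex.I * ((n : ℂ) + 1) * x)) (g x)) :
    HasSum (fun n => ‖c n‖ ^ 2) (∫ x in (-(1 : ℝ) / 2)..(1 / 2), ‖g x‖ ^ 2) := by
  have hexp (n : ℕ) (x : ℝ) : ‖Complex.exp (2 * π * Complex.I * ((n : ℂ) + 1) * x)‖ = 1 := by
    rw [Complex.norm_exp]; simp
  let u (n : ℕ) (x : ℝ) : ℂ := c n * Complex.exp (2 * π * Complex.I * ((n : ℂ) + 1) * x)
  have hu (n : ℕ) (x : ℝ) : ‖u n x‖ = ‖c n‖ := by simp only [u, norm_mul, hexp, mul_one]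
  let F (p : ℕ × ℕ) (x : ℝ) : ℂ := u p.1 x * (starRingEnd ℂ) (u p.2 x)
  have hF_norm (p : ℕ × ℕ) (x : ℝ) : ‖F p x‖ = ‖c p.1‖ * ‖c p.2‖ := by
    simp only [F, norm_mul, hu, RCLike.norm_conj]
  have hF_cont (p : ℕ × ℕ) : Continuous (F p) := by
    simp only [F, u]; fun_prop
  have hcc : Summable fun p : ℕ × ℕ => ‖c p.1‖ * ‖c p.2‖ :=
    hc.mul_of_nonneg hc (fun _ => norm_nonneg _) (fun _ => norm_nonneg _)
  have hF_sum (x : ℝ) : HasSum (fun p => F p x) ((‖g x‖ ^ 2 : ℝ) : ℂ) := by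
    have h := (hg x).mul ((Complex.hasSum_conj'.mpr (hg x)))
      (Summable.of_norm (hcc.congr fun p => (hF_norm p x).symm))
    rw [Complex.mul_conj', ← Complex.ofReal_pow] at h
    exact h
  have hF_int (p : ℕ × ℕ) : ∫ x in (-(1 : ℝ) / 2)..(1 / 2), F p x =
      if p.1 = p.2 then ((‖c p.1‖ ^ 2 : ℝ) : ℂ) else 0 := by
    have hF_eq (x : ℝ) : F p x = c p.1 * (starRingEnd ℂ) (c p.2) *
        Complex.exp ((2 * π * Complex.I * ((p.1 : ℂ) - p.2)) * x) := by
      have : (2 * π * Complex.I * ((p.1 : ℂ) - p.2)) * x =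
          2 * π * Complex.I * ((p.1 : ℂ) + 1) * x +
            (starRingEnd ℂ) (2 * π * Complex.I * ((p.2 : ℂ) + 1) * x) := by
        simp only [map_mul, map_add, map_one, map_ofNat, map_natCast, Complex.conj_I,
          Complex.conj_ofReal]
        ring
      rw [this, Complex.exp_add, Complex.exp_conj]
      simp only [F, u, map_mul]; ring
    simp_rw [hF_eq]
    split_ifs with h
    · simp only [h, sub_self, mul_zero, zero_mul, Complex.exp_zero, mul_one, Complex.mul_conj']
      simp; norm_num
    · have h0 : (p.1 : ℂ) - p.2 ≠ 0 := sub_ne_zero.mpr (by exact_mod_cast h)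
      rw [intervalIntegral.integral_const_mul,
        integral_exp_mul_complex (by simp [h0, Real.pi_ne_zero])]
      have : Complex.exp (2 * π * Complex.I * ((p.1 : ℂ) - p.2) * ((1 / 2 : ℝ) : ℂ)) =
          Complex.exp (2 * π * Complex.I * ((p.1 : ℂ) - p.2) * ((-1 / 2 : ℝ) : ℂ)) := by
        rw [Complex.exp_eq_exp_iff_exists_int]
        refine ⟨(p.1 : ℤ) - p.2, ?_⟩
        push_cast; ring
      rw [this]; simp
  have key : HasSum (fun p => ∫ x in (-(1 : ℝ) / 2)..(1 / 2), F p x)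
      (∫ x in (-(1 : ℝ) / 2)..(1 / 2), ((‖g x‖ ^ 2 : ℝ) : ℂ)) := by
    refine intervalIntegral.hasSum_integral_of_dominated_convergence
      (fun p _ => ‖c p.1‖ * ‖c p.2‖) (fun p => (hF_cont p).aestronglyMeasurable)
      (fun p => .of_forall fun x _ => (hF_norm p x).le) (.of_forall fun x _ => hcc)
      (by simp) (.of_forall fun x _ => hF_sum x)
  simp_rw [hF_int] at key
  rw [intervalIntegral.integral_ofReal] at key
  have hinj : Function.Injective fun n : ℕ => (n, n) := fun m n h => (Prod.mk.inj h).1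
  rw [← hinj.hasSum_iff] at key
  · simp only [Function.comp_def, if_true] at key
    exact_mod_cast key
  · rintro ⟨m, n⟩ hp
    rw [if_neg]
    exact fun h => hp ⟨m, Prod.ext rfl h⟩

theorem pow_le_exp_half {k : ℕ} (hk : 4 ≤ k) {t : ℝ} (ht : 16 * k * Real.log k ≤ t) :
    t ^ (k - 2) ≤ Real.exp (t / 2) := by
  have hk' : (4 : ℝ) ≤ k := by exact_mod_cast hk
  have hlog4 : Real.log 4 ≤ Real.log k := Real.log_le_log (by norm_num) hk'
  have hlog4' : 1 < Real.log 4 := by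
    rw [Real.lt_log_iff_exp_lt (by norm_num)]
    exact Real.exp_one_lt_three.trans (by norm_num)
  have ht0 : 0 < t := lt_of_lt_of_le (by have : 0 < Real.log k := by linarith
                                         positivity) ht
  have hlogt : Real.log t ≤ t / (4 * k) + Real.log 4 + Real.log k - 1 := by
    have h := Real.log_le_sub_one_of_pos (show 0 < t / (4 * k) by positivity)
    rw [Real.log_div ht0.ne' (by positivity), Real.log_mul (by norm_num) (by positivity)] at h
    linarith
  have hB : Real.log t ≤ t / (4 * k) + 2 * Real.log k := by linarith
  have hB0 : 0 ≤ t / (4 * k) + 2 * Real.log k := by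
    have : 0 < Real.log k := by linarith
    positivity
  rw [← Real.log_le_log_iff (by positivity) (Real.exp_pos _), Real.log_exp, Real.log_pow]
  have hk2 : ((k - 2 : ℕ) : ℝ) ≤ k := by exact_mod_cast Nat.sub_le k 2
  calc ((k - 2 : ℕ) : ℝ) * Real.log t
      ≤ ((k - 2 : ℕ) : ℝ) * (t / (4 * k) + 2 * Real.log k) := by gcongr
    _ ≤ k * (t / (4 * k) + 2 * Real.log k) := by gcongr
    _ = t / 4 + 2 * (k * Real.log k) := by field_simp
    _ ≤ t / 2 := by linarith

/-- The mass of `∑ bₙ e^{-αₙ y}` over `(T, ∞)` bounds the integral of any function it dominates. -/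
theorem setIntegral_Ioi_le_tsum_exp {T : ℝ} {F : ℝ → ℝ} {b α : ℕ → ℝ} (hb : ∀ n, 0 ≤ b n)
    (hα : ∀ n, 0 < α n)
    (hF : ∀ y, T < y → |F y| ≤ ∑' n, b n * Real.exp (-α n * y))
    (hs : ∀ y, T < y → Summable fun n => b n * Real.exp (-α n * y))
    (hsum : Summable fun n => b n * (Real.exp (-α n * T) / α n)) :
    ∫ y in Set.Ioi T, F y ≤ ∑' n, b n * (Real.exp (-α n * T) / α n) := by
  have hint (n : ℕ) : ∫⁻ y in Set.Ioi T, ENNReal.ofReal (b n * Real.exp (-α n * y)) =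
      ENNReal.ofReal (b n * (Real.exp (-α n * T) / α n)) := by
    have hα' : -α n < 0 := neg_lt_zero.mpr (hα n)
    rw [← ofReal_integral_eq_lintegral_ofReal ((integrableOn_exp_mul_Ioi hα' T).const_mul (b n))
      (.of_forall fun y => mul_nonneg (hb n) (Real.exp_pos _).le), integral_const_mul,
      integral_exp_mul_Ioi hα', neg_div_neg_eq]
  have h : ‖∫ y in Set.Ioi T, F y‖ₑ ≤
      ENNReal.ofReal (∑' n, b n * (Real.exp (-α n * T) / α n)) := by
    calc ‖∫ y in Set.Ioi T, F y‖ₑ ≤ ∫⁻ y in Set.Ioi T, ‖F y‖ₑ :=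
          enorm_integral_le_lintegral_enorm _
      _ ≤ ∫⁻ y in Set.Ioi T, ∑' n, ENNReal.ofReal (b n * Real.exp (-α n * y)) := by
          refine setLIntegral_mono' measurableSet_Ioi fun y hy => ?_
          rw [← ENNReal.ofReal_tsum_of_nonneg (fun n => mul_nonneg (hb n) (Real.exp_pos _).le)
            (hs y hy), Real.enorm_eq_ofReal_abs]
          exact ENNReal.ofReal_le_ofReal (hF y hy)
      _ = ∑' n, ENNReal.ofReal (b n * (Real.exp (-α n * T) / α n)) := by
          rw [lintegral_tsum fun n => by fun_prop]
          simp_rw [hint]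
      _ = ENNReal.ofReal (∑' n, b n * (Real.exp (-α n * T) / α n)) :=
          (ENNReal.ofReal_tsum_of_nonneg (fun n => mul_nonneg (hb n)
            (div_nonneg (Real.exp_pos _).le (hα n).le)) hsum).symm
  rw [Real.enorm_eq_ofReal_abs, ENNReal.ofReal_le_ofReal_iff
    (tsum_nonneg fun n => mul_nonneg (hb n) (div_nonneg (Real.exp_pos _).le (hα n).le))] at h
  exact (le_abs_self _).trans h

/-- For a holomorphic cusp form `f` of even weight `k ≥ 4` for `SL(2,ℤ)`
with Fourier coefficients `a`, if `T ≥ 4k log k` then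
`∫_T^∞ ∫_{−1/2}^{1/2} y^(k−2) |f(x+iy)|² dx dy ≤ 2 (4π)^(1−k) ∑_{n=1}^∞ |a(n)|² n^(1−k) e^(−2πnT)`. -/
theorem integral_le_two_mul_tsum
    (k : ℕ) (f : ℂ → ℂ) (a : ℕ → ℂ)
    (hk : Even k) (hk4 : 4 ≤ k)
    (hol : DifferentiableOn ℂ f {z : ℂ | 0 < z.im})
    (hmod : ∀ γ : Matrix.SpecialLinearGroup (Fin 2) ℤ, ∀ z : ℂ, 0 < z.im →
      f ((((γ 0 0 : ℤ) : ℂ) * z + ((γ 0 1 : ℤ) : ℂ)) /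
          (((γ 1 0 : ℤ) : ℂ) * z + ((γ 1 1 : ℤ) : ℂ)))
        = (((γ 1 0 : ℤ) : ℂ) * z + ((γ 1 1 : ℤ) : ℂ)) ^ k * f z)
    (hfourier : ∀ z : ℂ, 0 < z.im →
      HasSum (fun n : ℕ =>
        a (n + 1) * Complex.exp (2 * Real.pi * Complex.I * ((n : ℂ) + 1) * z)) (f z))
    (T : ℝ) (hT : 4 * k * Real.log k ≤ T) :
    (∫ y in Set.Ioi T, ∫ x in (-(1 : ℝ) / 2)..(1 / 2),
        y ^ (k - 2) * ‖f (x + y * Complex.I)‖ ^ 2) ≤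
      2 * (4 * Real.pi) ^ (1 - (k : ℤ)) *
        ∑' n : ℕ, ‖a (n + 1)‖ ^ 2 * ((n : ℝ) + 1) ^ (1 - (k : ℤ)) *
          Real.exp (-2 * Real.pi * ((n : ℝ) + 1) * T) := by
  have hk' : (4 : ℝ) ≤ k := by exact_mod_cast hk4
  have hT0 : 0 < T := by
    have : 0 < Real.log k := Real.log_pos (by linarith)
    exact lt_of_lt_of_le (by positivity) hT
  have hpars (y : ℝ) (hy : 0 < y) :
      HasSum (fun n : ℕ => ‖a (n + 1)‖ ^ 2 * Real.exp (-(4 * π * (n + 1)) * y))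
        (∫ x in (-(1 : ℝ) / 2)..(1 / 2), ‖f (x + y * Complex.I)‖ ^ 2) := by
    have hsplit (n : ℕ) (x : ℝ) :
        a (n + 1) * Complex.exp (2 * π * Complex.I * ((n : ℂ) + 1) * (x + y * Complex.I)) =
        a (n + 1) * (Real.exp (-(2 * π * (n + 1)) * y) : ℝ) *
          Complex.exp (2 * π * Complex.I * ((n : ℂ) + 1) * x) := by
      rw [mul_assoc (a (n + 1)), Complex.ofReal_exp, ← Complex.exp_add]
      congr 2
      push_cast
      linear_combination (2 * π * ((n : ℂ) + 1) * y) * Complex.I_sq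
    have hg (x : ℝ) := hfourier (x + y * Complex.I) (by simpa using hy)
    simp_rw [hsplit] at hg
    have hc : Summable fun n : ℕ =>
        ‖a (n + 1) * ((Real.exp (-(2 * π * (n + 1)) * y) : ℝ) : ℂ)‖ := by
      simpa using (hg 0).summable.norm
    refine (hasSum_sq_norm_fourierSeries _ hc _ hg).congr_fun fun n => ?_
    rw [norm_mul, mul_pow, Complex.norm_real, Real.norm_of_nonneg (Real.exp_pos _).le,
      ← Real.exp_nat_mul]
    congr 2
    push_cast; ring
  let b (n : ℕ) : ℝ := ‖a (n + 1)‖ ^ 2 * ((4 * π * (n + 1)) ^ (k - 2))⁻¹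
  let α (n : ℕ) : ℝ := 2 * π * (n + 1)
  have hα (n : ℕ) : 0 < α n := by positivity
  have hb (n : ℕ) : 0 ≤ b n := by positivity
  have hone (n : ℕ) : 1 ≤ 4 * π * ((n : ℝ) + 1) := by
    nlinarith [Real.pi_gt_three, mul_nonneg Real.pi_pos.le (Nat.cast_nonneg (α := ℝ) n)]
  have hs (y : ℝ) (hy : 0 < y) : Summable fun n => b n * Real.exp (-α n * y) := by
    refine (hpars (y / 2) (by positivity)).summable.of_nonneg_of_le
      (fun n => mul_nonneg (hb n) (Real.exp_pos _).le) fun n => ?_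
    have h1 : b n ≤ ‖a (n + 1)‖ ^ 2 :=
      mul_le_of_le_one_right (by positivity) (inv_le_one_of_one_le₀ (one_le_pow₀ (hone n)))
    have h2 : -α n * y = -(4 * π * (n + 1)) * (y / 2) := by simp only [α]; ring
    rw [h2]
    gcongr
  have hsum : Summable fun n => b n * (Real.exp (-α n * T) / α n) := by
    refine (hs T hT0).of_nonneg_of_le
      (fun n => mul_nonneg (hb n) (div_nonneg (Real.exp_pos _).le (hα n).le)) fun n => ?_
    refine mul_le_mul_of_nonneg_left (div_le_self (Real.exp_pos _).le ?_) (hb n)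
    simp only [α]
    nlinarith [Real.pi_gt_three, mul_nonneg Real.pi_pos.le (Nat.cast_nonneg (α := ℝ) n)]
  have hF (y : ℝ) (hy : T < y) :
      |∫ x in (-(1 : ℝ) / 2)..(1 / 2), y ^ (k - 2) * ‖f (x + y * Complex.I)‖ ^ 2| ≤
        ∑' n, b n * Real.exp (-α n * y) := by
    have hy0 : 0 < y := hT0.trans hy
    have hP := (hpars y hy0).mul_left (y ^ (k - 2))
    rw [intervalIntegral.integral_const_mul,
      abs_of_nonneg (hP.nonneg fun n => by positivity), ← hP.tsum_eq]
    refine hP.summable.tsum_le_tsum (fun n => ?_) (hs y hy0)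
    have ht : 16 * k * Real.log k ≤ 4 * π * (n + 1) * y := by
      have h4 : 4 ≤ 4 * π * ((n : ℝ) + 1) := by
        nlinarith [Real.pi_gt_three, mul_nonneg Real.pi_pos.le (Nat.cast_nonneg (α := ℝ) n)]
      nlinarith
    have hpow := pow_le_exp_half hk4 ht
    rw [mul_pow] at hpow
    have hexp : Real.exp (-α n * y) =
        Real.exp (4 * π * (n + 1) * y / 2) * Real.exp (-(4 * π * (n + 1)) * y) := by
      rw [← Real.exp_add]; congr 1; simp only [α]; ring
    have hy_le : y ^ (k - 2) ≤
        ((4 * π * (n + 1)) ^ (k - 2))⁻¹ * Real.exp (4 * π * (n + 1) * y / 2) := by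
      rwa [inv_mul_eq_div, le_div_iff₀' (by positivity)]
    calc y ^ (k - 2) * (‖a (n + 1)‖ ^ 2 * Real.exp (-(4 * π * (n + 1)) * y))
        ≤ (((4 * π * (n + 1)) ^ (k - 2))⁻¹ * Real.exp (4 * π * (n + 1) * y / 2)) *
          (‖a (n + 1)‖ ^ 2 * Real.exp (-(4 * π * (n + 1)) * y)) := by gcongr
      _ = b n * Real.exp (-α n * y) := by rw [hexp]; simp only [b]; ring
  refine (setIntegral_Ioi_le_tsum_exp hb hα hF (fun y hy => hs y (hT0.trans hy)) hsum).trans_eq ?_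
  rw [← tsum_mul_left]
  refine tsum_congr fun n => ?_
  have hz : (1 - (k : ℤ)) = -((k - 2 : ℕ) : ℤ) - 1 := by omega
  have hn : (n : ℝ) + 1 ≠ 0 := by positivity
  have hE : -2 * π * ((n : ℝ) + 1) * T = -α n * T := by simp only [α]; ring
  rw [hE, hz, zpow_sub_one₀ (by positivity), zpow_sub_one₀ hn, zpow_neg, zpow_neg, zpow_natCast,
    zpow_natCast]
  simp only [b, α, mul_pow]
  field_simp
  ring
end

section
/- For every T > 0, ∫_T^∞ ∫_{−1/2}^{1/2} y^{k−2} |f(x+iy)|² dx dy = (4π)^{1−k} ∑_{n=1}^∞ |a(n)|² n^{1−k} Γ(k−1, 4πnT). -/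
open Real MeasureTheory

/-- The upper incomplete gamma function `Γ(s, x) = ∫_x^∞ t^(s−1) e^(−t) dt`. -/
noncomputable def upperGamma (s x : ℝ) : ℝ :=
  ∫ t in Set.Ioi x, t ^ (s - 1) * Real.exp (-t)

/-- Orthogonality of the characters `x ↦ e(m x)` on the unit interval. -/
lemma integral_exp_mul_conj_exp (m n : ℕ) :
    ∫ x in (-(1 : ℝ) / 2)..(1 / 2),
      Complex.exp (2 * π * Complex.I * ((m : ℂ) - n) * x) = if m = n then 1 else 0 := by
  split_ifs with h
  · subst h
    simp
    norm_num
  · have h0 : (m : ℂ) - n ≠ 0 := sub_ne_zero.mpr (by exact_mod_cast h)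
    have h1 : 2 * π * Complex.I * ((m : ℂ) - n) ≠ 0 := mul_ne_zero Complex.two_pi_I_ne_zero h0
    rw [integral_exp_mul_complex h1, div_eq_zero_iff]
    left
    rw [sub_eq_zero, Complex.exp_eq_exp_iff_exists_int]
    refine ⟨(m : ℤ) - n, ?_⟩
    push_cast
    ring

/-- Parseval's identity for an absolutely convergent Fourier series. -/
lemma hasSum_norm_sq_integral_of_hasSum_exp {c : ℕ → ℂ} (hc : Summable fun n => ‖c n‖)
    {g : ℝ → ℂ}
    (hg : ∀ x : ℝ, HasSum (fun n => c n * Complex.exp (2 * π * Complex.I * ((n : ℂ) + 1) * x)) (g x)) :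
    HasSum (fun n => ‖c n‖ ^ 2) (∫ x in (-(1 : ℝ) / 2)..(1 / 2), ‖g x‖ ^ 2) := by
  let F : ℕ × ℕ → C(ℝ, ℂ) := fun p =>
    ⟨fun x => c p.1 * (starRingEnd ℂ) (c p.2) *
      Complex.exp (2 * π * Complex.I * ((p.1 : ℂ) - p.2) * x), by fun_prop⟩
  have hnexp (m : ℂ) (hm : m.im = 0) (x : ℝ) : ‖Complex.exp (2 * π * Complex.I * m * x)‖ = 1 := by
    rw [Complex.norm_exp]
    simp [hm]
  have hFn (p : ℕ × ℕ) (x : ℝ) : ‖F p x‖ = ‖c p.1‖ * ‖c p.2‖ := by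
    simp only [F, ContinuousMap.coe_mk, norm_mul, RCLike.norm_conj]
    rw [hnexp _ (by simp), mul_one]
  have hprod : Summable fun p : ℕ × ℕ => ‖c p.1‖ * ‖c p.2‖ :=
    hc.mul_of_nonneg hc (fun _ => norm_nonneg _) (fun _ => norm_nonneg _)
  have hFs : Summable fun p => ‖(F p).restrict
      (⟨Set.uIcc (-(1 : ℝ) / 2) (1 / 2), isCompact_uIcc⟩ : TopologicalSpace.Compacts ℝ)‖ := by
    refine Summable.of_nonneg_of_le (fun _ => norm_nonneg _) (fun p => ?_) hprod
    rw [ContinuousMap.norm_le _ (by positivity)]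
    intro x
    exact (hFn p x).le
  have hpt (x : ℝ) : ∑' p, F p x = ((‖g x‖ ^ 2 : ℝ) : ℂ) := by
    have hn : Summable fun n => ‖c n * Complex.exp (2 * π * Complex.I * ((n : ℂ) + 1) * x)‖ := by
      refine hc.congr fun n => ?_
      rw [norm_mul, hnexp _ (by simp), mul_one]
    have hn' : Summable fun n => ‖(starRingEnd ℂ)
        (c n * Complex.exp (2 * π * Complex.I * ((n : ℂ) + 1) * x))‖ := by
      simpa only [RCLike.norm_conj] using hn
    have h := tsum_mul_tsum_of_summable_norm hn hn'
    rw [← Complex.conj_tsum, (hg x).tsum_eq, Complex.mul_conj, Complex.normSq_eq_norm_sq] at h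
    rw [h]
    refine tsum_congr fun p => ?_
    simp only [F, ContinuousMap.coe_mk, map_mul, ← Complex.exp_conj, Complex.conj_ofReal,
      Complex.conj_I, map_add, map_natCast, map_one, map_ofNat]
    rw [mul_mul_mul_comm, ← Complex.exp_add]
    congr 2
    ring
  have hsum := intervalIntegral.hasSum_intervalIntegral_of_summable_norm hFs
  simp only [hpt] at hsum
  rw [intervalIntegral.integral_ofReal] at hsum
  have hint (p : ℕ × ℕ) : ∫ x in (-(1 : ℝ) / 2)..(1 / 2), F p x =
      if p.1 = p.2 then c p.1 * (starRingEnd ℂ) (c p.2) else 0 := by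
    simp only [F, ContinuousMap.coe_mk]
    rw [intervalIntegral.integral_const_mul, integral_exp_mul_conj_exp]
    simp
  simp only [hint] at hsum
  have hdiag : Function.Injective fun n : ℕ => (n, n) := fun m n h => (Prod.ext_iff.mp h).1
  rw [← hdiag.hasSum_iff] at hsum
  · rw [← Complex.hasSum_ofReal]
    refine hsum.congr_fun fun n => ?_
    simp [Complex.mul_conj, Complex.normSq_eq_norm_sq]
  · rintro ⟨m, n⟩ hmn
    refine if_neg fun h => hmn ⟨m, ?_⟩
    simpa using h

lemma integral_Ioi_pow_mul_exp_neg_mul {k : ℕ} (hk : 2 ≤ k) {r T : ℝ} (hr : 0 < r) :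
    ∫ y in Set.Ioi T, y ^ (k - 2) * Real.exp (-(r * y)) =
      r ^ (1 - (k : ℤ)) * upperGamma ((k : ℝ) - 1) (r * T) := by
  have h := integral_comp_mul_left_Ioi
    (fun t : ℝ => t ^ (((k : ℝ) - 1) - 1) * Real.exp (-t)) T hr
  have hexp : ((k : ℝ) - 1) - 1 = ((k - 2 : ℕ) : ℝ) := by
    push_cast [hk]
    ring
  have hr1 : r ^ (1 - (k : ℤ)) = r⁻¹ * (r ^ (k - 2))⁻¹ := by
    rw [← zpow_natCast, ← zpow_neg, ← zpow_neg_one, ← zpow_add₀ hr.ne']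
    congr 1
    omega
  rw [smul_eq_mul] at h
  rw [upperGamma, hr1, mul_right_comm, ← h]
  simp only [hexp, Real.rpow_natCast, mul_pow]
  rw [mul_comm, ← integral_const_mul]
  congr 1
  ext y
  field_simp

lemma integrableOn_Ioi_pow_mul_exp_neg_mul (j : ℕ) {r T : ℝ} (hr : 0 < r) (hT : 0 ≤ T) :
    IntegrableOn (fun y : ℝ => y ^ j * Real.exp (-(r * y))) (Set.Ioi T) := by
  have h := integrableOn_rpow_mul_exp_neg_mul_rpow (s := j) (p := 1) (b := r)
    (by linarith [Nat.cast_nonneg (α := ℝ) j]) one_pos hr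
  simp only [Real.rpow_natCast, Real.rpow_one, neg_mul] at h
  exact h.mono_set (Set.Ioi_subset_Ioi hT)

/-- For a holomorphic cusp form `f` of even weight `k ≥ 4` for `SL(2,ℤ)`
with Fourier coefficients `a`, for every `T > 0`,
`∫_T^∞ ∫_{−1/2}^{1/2} y^(k−2) |f(x+iy)|² dx dy = (4π)^(1−k) ∑_{n=1}^∞ |a(n)|² n^(1−k) Γ(k−1, 4πnT)`. -/
theorem integral_eq_tsum_upperGamma
    (k : ℕ) (f : ℂ → ℂ) (a : ℕ → ℂ)
    (hk : Even k) (hk4 : 4 ≤ k)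
    (hol : DifferentiableOn ℂ f {z : ℂ | 0 < z.im})
    (hmod : ∀ γ : Matrix.SpecialLinearGroup (Fin 2) ℤ, ∀ z : ℂ, 0 < z.im →
      f ((((γ 0 0 : ℤ) : ℂ) * z + ((γ 0 1 : ℤ) : ℂ)) /
          (((γ 1 0 : ℤ) : ℂ) * z + ((γ 1 1 : ℤ) : ℂ)))
        = (((γ 1 0 : ℤ) : ℂ) * z + ((γ 1 1 : ℤ) : ℂ)) ^ k * f z)
    (hfourier : ∀ z : ℂ, 0 < z.im →
      HasSum (fun n : ℕ =>
        a (n + 1) * Complex.exp (2 * Real.pi * Complex.I * ((n : ℂ) + 1) * z)) (f z))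
    (T : ℝ) (hT : 0 < T) :
    (∫ y in Set.Ioi T, ∫ x in (-(1 : ℝ) / 2)..(1 / 2),
        y ^ (k - 2) * ‖f (x + y * Complex.I)‖ ^ 2) =
      (4 * Real.pi) ^ (1 - (k : ℤ)) *
        ∑' n : ℕ, ‖a (n + 1)‖ ^ 2 * ((n : ℝ) + 1) ^ (1 - (k : ℤ)) *
          upperGamma ((k : ℝ) - 1) (4 * Real.pi * ((n : ℝ) + 1) * T) := by
  have hexp (n : ℕ) (x y : ℝ) :
      a (n + 1) * Complex.exp (2 * π * Complex.I * ((n : ℂ) + 1) * (x + y * Complex.I)) =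
        a (n + 1) * (Real.exp (-(2 * π * (n + 1) * y)) : ℝ) *
          Complex.exp (2 * π * Complex.I * ((n : ℂ) + 1) * x) := by
    rw [mul_assoc (a (n + 1)), Complex.ofReal_exp, ← Complex.exp_add]
    congr 2
    push_cast
    linear_combination (2 * π * ((n : ℂ) + 1) * y) * Complex.I_mul_I
  have hsq (n : ℕ) (y : ℝ) : ‖a (n + 1) * (Real.exp (-(2 * π * (n + 1) * y)) : ℝ)‖ ^ 2 =
      ‖a (n + 1)‖ ^ 2 * Real.exp (-(4 * π * (n + 1) * y)) := by
    rw [norm_mul, mul_pow, Complex.norm_real, Real.norm_eq_abs, sq_abs, ← Real.exp_nat_mul]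
    congr 2
    push_cast
    ring
  have hser (y : ℝ) (hy : 0 < y) (x : ℝ) := by
    have h := hfourier (x + y * Complex.I) (by simpa using hy)
    simp only [hexp] at h
    exact h
  have hsummable (y : ℝ) (hy : 0 < y) :
      Summable fun n : ℕ => ‖a (n + 1) * (Real.exp (-(2 * π * (n + 1) * y)) : ℝ)‖ := by
    simpa using (hser y hy 0).summable.norm
  have hparseval (y : ℝ) (hy : 0 < y) :=
    hasSum_norm_sq_integral_of_hasSum_exp (g := fun x => f (x + y * Complex.I))
      (hsummable y hy) (hser y hy)
  simp only [hsq] at hparseval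
  set G : ℕ → ℝ → ℝ := fun n y =>
    ‖a (n + 1)‖ ^ 2 * (y ^ (k - 2) * Real.exp (-(4 * π * (n + 1) * y))) with hG
  have hGint (n : ℕ) : Integrable (G n) (volume.restrict (Set.Ioi T)) :=
    (integrableOn_Ioi_pow_mul_exp_neg_mul (k - 2) (by positivity) hT.le).const_mul _
  have hGnonneg (n : ℕ) : ∀ y ∈ Set.Ioi T, 0 ≤ G n y := fun y hy => by
    have : 0 < y := hT.trans hy
    positivity
  have hGsum : Summable fun n => ∫ y in Set.Ioi T, ‖G n y‖ := by
    have hmajor := ((hparseval (T / 2) (by positivity)).summable).mul_right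
      (∫ y in Set.Ioi T, y ^ (k - 2) * Real.exp (-(2 * π * y)))
    refine hmajor.of_nonneg_of_le (fun n => integral_nonneg fun y => norm_nonneg _) fun n => ?_
    rw [← integral_const_mul]
    refine setIntegral_mono_on (hGint n).norm
      ((integrableOn_Ioi_pow_mul_exp_neg_mul (k - 2) (by positivity) hT.le).const_mul _)
      measurableSet_Ioi fun y hy => ?_
    have hy' : T < y := hy
    have hy0 : 0 < y := hT.trans hy'
    rw [Real.norm_of_nonneg (hGnonneg n y hy)]
    have hle : Real.exp (-(4 * π * (n + 1) * y)) ≤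
        Real.exp (-(4 * π * (n + 1) * (T / 2))) * Real.exp (-(2 * π * y)) := by
      rw [← Real.exp_add]
      gcongr
      have h1 : 0 ≤ 2 * π * (n + 1) * (y - T) := by
        have := sub_nonneg.mpr hy'.le
        positivity
      have h2 : 0 ≤ 2 * π * n * y := by positivity
      linarith
    calc G n y ≤ ‖a (n + 1)‖ ^ 2 * (y ^ (k - 2) *
          (Real.exp (-(4 * π * (n + 1) * (T / 2))) * Real.exp (-(2 * π * y)))) := by
          simp only [hG]
          gcongr
      _ = _ := by ring
  have hmain := (hasSum_integral_of_summable_integral_norm hGint hGsum).tsum_eq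
  have hleft : (∫ y in Set.Ioi T, ∫ x in (-(1 : ℝ) / 2)..(1 / 2),
      y ^ (k - 2) * ‖f (x + y * Complex.I)‖ ^ 2) = ∫ y in Set.Ioi T, ∑' n, G n y := by
    refine setIntegral_congr_fun measurableSet_Ioi fun y hy => ?_
    simp only [hG]
    rw [intervalIntegral.integral_const_mul, ← (hparseval y (hT.trans hy)).tsum_eq,
      ← tsum_mul_left]
    exact tsum_congr fun n => by ring
  rw [hleft, ← hmain, ← tsum_mul_left]
  refine tsum_congr fun n => ?_
  simp only [hG]
  rw [integral_const_mul, integral_Ioi_pow_mul_exp_neg_mul (by omega) (by positivity), mul_zpow]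
  ring
end
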